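/- arXiv:1104.3917 — 3 statements merged into one kernel-verified Lean document; each statement's English description precedes it below -/
import Mathlib

section
/- A finite simple graph G is a special 2-threshold graph if and only if G has no induced subgraph isomorphic to any of the following eight graphs: 2K2, C5, the net, the house, the gem, the octahedron, the 4-wheel with a pendant vertex attached to its center, or the diamond with a pendant vertex attached to each of its two degree-three vertices. -/
/-- `G` is a special 2-threshold graph: there is a black-and-white coloring `c`
(white = `true`) and a linear ordering of the vertices (given by `e : Fin n ≃ V`) such
that every vertex is either nonadjacent to all earlier vertices, or adjacent to exactly
the white earlier vertices. -/
def IsSpecial2Threshold {V : Type*} (G : SimpleGraph V) : Prop :=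
  ∃ (n : ℕ) (e : Fin n ≃ V) (c : V → Bool), ∀ i : Fin n,
    (∀ j : Fin n, j < i → ¬ G.Adj (e i) (e j)) ∨
    (∀ j : Fin n, j < i → (G.Adj (e i) (e j) ↔ c (e j) = true))

/-- The simple graph on `Fin n` with the given list of edges. -/
def graphOfEdges (n : ℕ) (E : List (Fin n × Fin n)) : SimpleGraph (Fin n) :=
  SimpleGraph.fromRel (fun a b => (a, b) ∈ E)

/-- `2K₂`: the disjoint union of two edges. -/
def twoK2 : SimpleGraph (Fin 4) := graphOfEdges 4 [(0, 1), (2, 3)]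

/-- `C₅`: the cycle on five vertices. -/
def cycle5 : SimpleGraph (Fin 5) := graphOfEdges 5 [(0, 1), (1, 2), (2, 3), (3, 4), (4, 0)]

/-- The net: a triangle `0,1,2` with pendant vertices `3,4,5` attached to its vertices. -/
def net : SimpleGraph (Fin 6) :=
  graphOfEdges 6 [(0, 1), (1, 2), (0, 2), (0, 3), (1, 4), (2, 5)]

/-- The house: a 4-cycle `0,1,2,3` together with a vertex `4` adjacent to the two
consecutive cycle vertices `0` and `1`. -/
def house : SimpleGraph (Fin 5) :=
  graphOfEdges 5 [(0, 1), (1, 2), (2, 3), (3, 0), (4, 0), (4, 1)]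

/-- The gem: a path `0-1-2-3` together with a vertex `4` adjacent to all path vertices. -/
def gem : SimpleGraph (Fin 5) :=
  graphOfEdges 5 [(0, 1), (1, 2), (2, 3), (4, 0), (4, 1), (4, 2), (4, 3)]

/-- The octahedron `K_{2,2,2}`: the complement of `3K₂`, with parts `{0,1}`, `{2,3}`, `{4,5}`. -/
def octahedron : SimpleGraph (Fin 6) :=
  graphOfEdges 6 [(0, 2), (0, 3), (0, 4), (0, 5), (1, 2), (1, 3), (1, 4), (1, 5),
    (2, 4), (2, 5), (3, 4), (3, 5)]

/-- The 4-wheel with a pendant vertex attached to its center: a 4-cycle `0,1,2,3`,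
a center `4` adjacent to all cycle vertices, and a pendant `5` adjacent only to `4`. -/
def wheel4Pendant : SimpleGraph (Fin 6) :=
  graphOfEdges 6 [(0, 1), (1, 2), (2, 3), (3, 0), (4, 0), (4, 1), (4, 2), (4, 3), (4, 5)]

/-- The diamond (K₄ minus the edge `(2,3)`) with a pendant vertex attached to each of its
two degree-three vertices `0` and `1`. -/
def diamondPendants : SimpleGraph (Fin 6) :=
  graphOfEdges 6 [(0, 1), (0, 2), (0, 3), (1, 2), (1, 3), (0, 4), (1, 5)]

set_option linter.unusedTactic false
set_option linter.unreachableTactic false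

namespace S2T

variable {V : Type*}

/-! ### Special 2-threshold graphs contain none of the forbidden graphs -/

/-- Every colouring of `H` admits a nonempty set from which no vertex can be peeled off. -/
def Stuck {n : ℕ} (H : SimpleGraph (Fin n)) : Prop :=
  ∀ c : Fin n → Bool, ∃ S : Finset (Fin n), S.Nonempty ∧ ∀ v ∈ S,
    (∃ u ∈ S, u ≠ v ∧ H.Adj v u) ∧ (∃ u ∈ S, u ≠ v ∧ ¬ (H.Adj v u ↔ c u = true))

instance (n : ℕ) (E : List (Fin n × Fin n)) : DecidableRel (graphOfEdges n E).Adj :=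
  fun a b => inferInstanceAs (Decidable (a ≠ b ∧ ((a, b) ∈ E ∨ (b, a) ∈ E)))

/-- It suffices to look at a list of candidate sets. -/
theorem stuck_of_list {n : ℕ} {H : SimpleGraph (Fin n)} (L : List (List (Fin n)))
    (h : ∀ c : Fin n → Bool, ∃ S ∈ L, S ≠ [] ∧ ∀ v ∈ S,
      (∃ u ∈ S, u ≠ v ∧ H.Adj v u) ∧ (∃ u ∈ S, u ≠ v ∧ ¬ (H.Adj v u ↔ c u = true))) :
    Stuck H := by
  intro c
  obtain ⟨S, -, hS, hv⟩ := h c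
  exact ⟨S.toFinset, by simpa [List.toFinset_nonempty_iff] using hS, by simpa using hv⟩

theorem isEmpty_of_stuck {n : ℕ} {H : SimpleGraph (Fin n)} (hH : Stuck H)
    {G : SimpleGraph V} (hG : IsSpecial2Threshold G) : IsEmpty (H ↪g G) := by
  refine ⟨fun f => ?_⟩
  obtain ⟨m, e, c, h⟩ := hG
  obtain ⟨S, hS, hv⟩ := hH (fun x => c (f x))
  obtain ⟨v, hvS, hmax⟩ := S.exists_max_image (fun x => e.symm (f x)) hS
  obtain ⟨⟨u, huS, huv, hu⟩, ⟨u', hu'S, hu'v, hu'⟩⟩ := hv v hvS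
  have key : ∀ x ∈ S, x ≠ v → e.symm (f x) < e.symm (f v) := fun x hx hxv =>
    lt_of_le_of_ne (hmax x hx) (fun hh => hxv (f.injective (e.symm.injective hh)))
  rcases h (e.symm (f v)) with h1 | h1
  · have := h1 _ (key u huS huv)
    simp only [Equiv.apply_symm_apply, f.map_adj_iff] at this
    exact this hu
  · have := h1 _ (key u' hu'S hu'v)
    simp only [Equiv.apply_symm_apply, f.map_adj_iff] at this
    exact hu' this

/-! ### Forbidden configurations in explicit form -/

section config
variable {G : SimpleGraph V}

theorem no_embed {n : ℕ} {E : List (Fin n × Fin n)} (h : IsEmpty (graphOfEdges n E ↪g G))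
    (f : Fin n → V)
    (hf : ∀ i j, i < j → (G.Adj (f i) (f j) ↔ (graphOfEdges n E).Adj i j) ∧
      (((graphOfEdges n E).Adj i j ∨ ∃ k, k ≠ i ∧ k ≠ j ∧
        ¬ ((graphOfEdges n E).Adj i k ↔ (graphOfEdges n E).Adj j k)) ∨ f i ≠ f j)) : False := by
  have hadj : ∀ i j, i ≠ j → (G.Adj (f i) (f j) ↔ (graphOfEdges n E).Adj i j) := by
    intro i j hij
    rcases lt_or_gt_of_ne hij with hlt | hlt
    · exact (hf i j hlt).1
    · rw [G.adj_comm, (graphOfEdges n E).adj_comm]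
      exact (hf j i hlt).1
  have hne : ∀ i j, i < j → f i ≠ f j := by
    intro i j hij he
    rcases (hf i j hij).2 with (h1 | ⟨k, hki, hkj, hk⟩) | h1
    · have := (hadj i j hij.ne).mpr h1
      rw [he] at this
      exact G.irrefl this
    · apply hk
      rw [← hadj i k hki.symm, ← hadj j k hkj.symm, he]
    · exact h1 he
  refine h.false ⟨⟨f, ?_⟩, ?_⟩
  · intro i j he
    by_contra hij
    rcases lt_or_gt_of_ne hij with hlt | hlt
    · exact hne i j hlt he
    · exact hne j i hlt he.symm
  · intro i j
    by_cases hij : i = j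
    · subst hij
      simp
    · exact hadj i j hij

theorem adj_case {p q r t : Prop} {a b : V} (hp : p = G.Adj a b)
    (h : (G.Adj a b ∧ q) ∨ (¬ G.Adj a b ∧ ¬ q)) (h' : r ∨ t) : (p ↔ q) ∧ (r ∨ t) := by
  subst hp
  exact ⟨by tauto, h'⟩

theorem no_twoK2 (h : IsEmpty (twoK2 ↪g G)) (a b c d : V) (ab : G.Adj a b) (cd : G.Adj c d)
    (ac : ¬ G.Adj a c) (ad : ¬ G.Adj a d) (bc : ¬ G.Adj b c) (bd : ¬ G.Adj b d) : False := by
  refine no_embed h ![a, b, c, d] ?_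
  intro i j hij
  fin_cases i <;> fin_cases j <;> first
    | exact absurd hij (by decide)
    | (refine adj_case rfl ?_ ?_
       · first
          | exact Or.inl ⟨by first | assumption | (rw [G.adj_comm]; assumption), by decide⟩
          | exact Or.inr ⟨by first | assumption | (rw [G.adj_comm]; assumption), by decide⟩
       · first
          | exact Or.inl (by decide)
          | exact Or.inr (by assumption))

theorem no_cycle5 (h : IsEmpty (cycle5 ↪g G)) (a b c d e : V) (ab : G.Adj a b) (bc : G.Adj b c)
    (cd : G.Adj c d) (de : G.Adj d e) (ea : G.Adj e a)
    (ac : ¬ G.Adj a c) (ad : ¬ G.Adj a d) (bd : ¬ G.Adj b d) (be : ¬ G.Adj b e)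
    (ce : ¬ G.Adj c e) : False := by
  refine no_embed h ![a, b, c, d, e] ?_
  intro i j hij
  fin_cases i <;> fin_cases j <;> first
    | exact absurd hij (by decide)
    | (refine adj_case rfl ?_ ?_
       · first
          | exact Or.inl ⟨by first | assumption | (rw [G.adj_comm]; assumption), by decide⟩
          | exact Or.inr ⟨by first | assumption | (rw [G.adj_comm]; assumption), by decide⟩
       · first
          | exact Or.inl (by decide)
          | exact Or.inr (by assumption))

theorem no_house (h : IsEmpty (house ↪g G)) (a b c d e : V) (ab : G.Adj a b) (bc : G.Adj b c)
    (cd : G.Adj c d) (da : G.Adj d a) (ea : G.Adj e a) (eb : G.Adj e b)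
    (ac : ¬ G.Adj a c) (bd : ¬ G.Adj b d) (ec : ¬ G.Adj e c) (ed : ¬ G.Adj e d) : False := by
  refine no_embed h ![a, b, c, d, e] ?_
  intro i j hij
  fin_cases i <;> fin_cases j <;> first
    | exact absurd hij (by decide)
    | (refine adj_case rfl ?_ ?_
       · first
          | exact Or.inl ⟨by first | assumption | (rw [G.adj_comm]; assumption), by decide⟩
          | exact Or.inr ⟨by first | assumption | (rw [G.adj_comm]; assumption), by decide⟩
       · first
          | exact Or.inl (by decide)
          | exact Or.inr (by assumption))

theorem no_gem (h : IsEmpty (gem ↪g G)) (a b c d e : V) (ab : G.Adj a b) (bc : G.Adj b c)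
    (cd : G.Adj c d) (ea : G.Adj e a) (eb : G.Adj e b) (ec : G.Adj e c) (ed : G.Adj e d)
    (ac : ¬ G.Adj a c) (ad : ¬ G.Adj a d) (bd : ¬ G.Adj b d) : False := by
  refine no_embed h ![a, b, c, d, e] ?_
  intro i j hij
  fin_cases i <;> fin_cases j <;> first
    | exact absurd hij (by decide)
    | (refine adj_case rfl ?_ ?_
       · first
          | exact Or.inl ⟨by first | assumption | (rw [G.adj_comm]; assumption), by decide⟩
          | exact Or.inr ⟨by first | assumption | (rw [G.adj_comm]; assumption), by decide⟩
       · first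
          | exact Or.inl (by decide)
          | exact Or.inr (by assumption))

theorem no_net (h : IsEmpty (net ↪g G)) (a b c x y z : V) (ab : G.Adj a b) (bc : G.Adj b c)
    (ac : G.Adj a c) (ax : G.Adj a x) (yb : G.Adj b y) (cz : G.Adj c z)
    (ay : ¬ G.Adj a y) (az : ¬ G.Adj a z) (bx : ¬ G.Adj b x) (bz : ¬ G.Adj b z)
    (cx : ¬ G.Adj c x) (cy : ¬ G.Adj c y) (xy : ¬ G.Adj x y) (xz : ¬ G.Adj x z)
    (yz : ¬ G.Adj y z) : False := by
  refine no_embed h ![a, b, c, x, y, z] ?_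
  intro i j hij
  fin_cases i <;> fin_cases j <;> first
    | exact absurd hij (by decide)
    | (refine adj_case rfl ?_ ?_
       · first
          | exact Or.inl ⟨by first | assumption | (rw [G.adj_comm]; assumption), by decide⟩
          | exact Or.inr ⟨by first | assumption | (rw [G.adj_comm]; assumption), by decide⟩
       · first
          | exact Or.inl (by decide)
          | exact Or.inr (by assumption))

theorem no_octahedron (h : IsEmpty (octahedron ↪g G)) (a a' b b' c c' : V)
    (ha : a ≠ a') (hb : b ≠ b') (hc : c ≠ c')
    (na : ¬ G.Adj a a') (nb : ¬ G.Adj b b') (nc : ¬ G.Adj c c')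
    (h1 : G.Adj a b) (h2 : G.Adj a b') (h3 : G.Adj a c) (h4 : G.Adj a c')
    (h5 : G.Adj a' b) (h6 : G.Adj a' b') (h7 : G.Adj a' c) (h8 : G.Adj a' c')
    (h9 : G.Adj b c) (h10 : G.Adj b c') (h11 : G.Adj b' c) (h12 : G.Adj b' c') : False := by
  refine no_embed h ![a, a', b, b', c, c'] ?_
  intro i j hij
  fin_cases i <;> fin_cases j <;> first
    | exact absurd hij (by decide)
    | (refine adj_case rfl ?_ ?_
       · first
          | exact Or.inl ⟨by first | assumption | (rw [G.adj_comm]; assumption), by decide⟩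
          | exact Or.inr ⟨by first | assumption | (rw [G.adj_comm]; assumption), by decide⟩
       · first
          | exact Or.inl (by decide)
          | exact Or.inr (by assumption))

theorem no_wheel (h : IsEmpty (wheel4Pendant ↪g G)) (a b c d e p : V)
    (hac : a ≠ c) (hbd : b ≠ d)
    (ab : G.Adj a b) (bc : G.Adj b c) (cd : G.Adj c d) (da : G.Adj d a)
    (ea : G.Adj e a) (eb : G.Adj e b) (ec : G.Adj e c) (ed : G.Adj e d) (ep : G.Adj e p)
    (ac : ¬ G.Adj a c) (bd : ¬ G.Adj b d)
    (pa : ¬ G.Adj p a) (pb : ¬ G.Adj p b) (pc : ¬ G.Adj p c) (pd : ¬ G.Adj p d) : False := by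
  refine no_embed h ![a, b, c, d, e, p] ?_
  intro i j hij
  fin_cases i <;> fin_cases j <;> first
    | exact absurd hij (by decide)
    | (refine adj_case rfl ?_ ?_
       · first
          | exact Or.inl ⟨by first | assumption | (rw [G.adj_comm]; assumption), by decide⟩
          | exact Or.inr ⟨by first | assumption | (rw [G.adj_comm]; assumption), by decide⟩
       · first
          | exact Or.inl (by decide)
          | exact Or.inr (by assumption))

theorem no_diamond (h : IsEmpty (diamondPendants ↪g G)) (a b c d p q : V)
    (hcd : c ≠ d) (ab : G.Adj a b) (ac : G.Adj a c) (ad : G.Adj a d) (bc : G.Adj b c)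
    (bd : G.Adj b d) (ap : G.Adj a p) (bq : G.Adj b q) (cd : ¬ G.Adj c d)
    (aq : ¬ G.Adj a q) (bp : ¬ G.Adj b p) (cp : ¬ G.Adj c p) (cq : ¬ G.Adj c q)
    (dp : ¬ G.Adj d p) (dq : ¬ G.Adj d q) (pq : ¬ G.Adj p q) : False := by
  refine no_embed h ![a, b, c, d, p, q] ?_
  intro i j hij
  fin_cases i <;> fin_cases j <;> first
    | exact absurd hij (by decide)
    | (refine adj_case rfl ?_ ?_
       · first
          | exact Or.inl ⟨by first | assumption | (rw [G.adj_comm]; assumption), by decide⟩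
          | exact Or.inr ⟨by first | assumption | (rw [G.adj_comm]; assumption), by decide⟩
       · first
          | exact Or.inl (by decide)
          | exact Or.inr (by assumption))

end config

/-! ### Good edges -/

/-- The non-neighbours of `w` are independent. -/
def InP (G : SimpleGraph V) (w : V) : Prop :=
  ∀ x y, ¬ G.Adj w x → ¬ G.Adj w y → ¬ G.Adj x y

section good
variable {G : SimpleGraph V}

/-- A vertex outside `P` is strictly dominated by one of its non-neighbours. -/
theorem dominated_of_not_inP (h1 : IsEmpty (twoK2 ↪g G)) (h2 : IsEmpty (cycle5 ↪g G))
    (h4 : IsEmpty (house ↪g G)) {w : V} (hw : ¬ InP G w) :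
    ∃ z, ¬ G.Adj w z ∧ (∀ u, G.Adj w u → G.Adj z u) ∧ ∃ t, G.Adj z t ∧ ¬ G.Adj w t := by
  unfold InP at hw
  push Not at hw
  obtain ⟨x, y, hx, hy, hxy⟩ := hw
  by_cases hxd : ∀ u, G.Adj w u → G.Adj x u
  · exact ⟨x, hx, hxd, y, hxy, hy⟩
  by_cases hyd : ∀ u, G.Adj w u → G.Adj y u
  · exact ⟨y, hy, hyd, x, hxy.symm, hx⟩
  push Not at hxd hyd
  obtain ⟨u, hwu, hxu⟩ := hxd
  obtain ⟨t, hwt, hyt⟩ := hyd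
  exfalso
  have hyu : G.Adj y u := by
    by_contra hyu
    exact no_twoK2 h1 w u x y hwu hxy hx hy (by grind [G.adj_comm]) (by grind [G.adj_comm])
  have hxt : G.Adj x t := by
    by_contra hxt
    exact no_twoK2 h1 w t x y hwt hxy hx hy (by grind [G.adj_comm]) (by grind [G.adj_comm])
  by_cases hut : G.Adj u t
  · exact no_house h4 u t x y w hut hxt.symm hxy hyu hwu hwt (by grind [G.adj_comm])
      (by grind [G.adj_comm]) hx hy
  · exact no_cycle5 h2 w u y x t hwu hyu.symm hxy.symm hxt hwt.symm hy hx
      (by grind [G.adj_comm]) hut hyt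

theorem mixed_or {p X Y : V → Prop}
    (m1 : ∀ x y, X x → Y y → p x → p y → False)
    (m2 : ∀ x y, X x → Y y → ¬ p x → ¬ p y → False)
    (m3 : ∀ x y, X x → X y → p x → ¬ p y → False)
    (m4 : ∀ x y, Y x → Y y → p x → ¬ p y → False) :
    ((∀ x, X x → p x) ∧ (∀ y, Y y → ¬ p y)) ∨ ((∀ x, X x → ¬ p x) ∧ (∀ y, Y y → p y)) := by
  by_cases h : ∃ x, X x
  · obtain ⟨x, hx⟩ := h
    by_cases hp : p x
    · exact Or.inl ⟨fun z hz => by_contra fun hn => m3 x z hx hz hp hn,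
        fun y hy hpy => m1 x y hx hy hp hpy⟩
    · exact Or.inr ⟨fun z hz hn => m3 z x hz hx hn hp,
        fun y hy => by_contra fun hpy => m2 x y hx hy hp hpy⟩
  · push Not at h
    by_cases hY : ∃ y, Y y ∧ p y
    · obtain ⟨y, hy, hp⟩ := hY
      exact Or.inr ⟨fun x hx => absurd hx (h x), fun z hz => by_contra fun hn => m4 y z hy hz hp hn⟩
    · push Not at hY
      exact Or.inl ⟨fun x hx => absurd hx (h x), hY⟩

variable [Fintype V]

theorem exists_inP_above (h1 : IsEmpty (twoK2 ↪g G)) (h2 : IsEmpty (cycle5 ↪g G))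
    (h4 : IsEmpty (house ↪g G)) (w : V) :
    ∃ z, InP G z ∧ ∀ u, G.Adj w u → G.Adj z u := by
  classical
  obtain ⟨z, hz, hmax⟩ := (Finset.univ.filter fun z => ∀ u, G.Adj w u → G.Adj z u).exists_max_image
    (fun z => (G.neighborFinset z).card) ⟨w, by simp⟩
  simp only [Finset.mem_filter, Finset.mem_univ, true_and] at hz hmax
  refine ⟨z, ?_, hz⟩
  by_contra hP
  obtain ⟨y, -, hy, t, hyt, hzt⟩ := dominated_of_not_inP h1 h2 h4 hP
  have := hmax y (fun u hu => hy u (hz u hu))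
  refine absurd this (not_le.mpr (Finset.card_lt_card ?_))
  refine Finset.ssubset_iff_subset_ne.mpr ⟨fun u => by simpa using hy u, fun he => hzt ?_⟩
  have : t ∈ G.neighborFinset y := by simpa using hyt
  rw [← he] at this
  simpa using this

/-- A good edge: the dichotomy from which the partition is read off. -/
structure Good (G : SimpleGraph V) (w v : V) : Prop where
  adj : G.Adj w v
  hw : InP G w
  hv : InP G v
  dom : ∀ d, ¬ G.Adj w d → ¬ G.Adj v d → ∀ u, ¬ G.Adj d u
  cl : ∀ k l, G.Adj w k → G.Adj v k → G.Adj w l → G.Adj v l → k ≠ l → G.Adj k l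

open Classical in
/-- The size of the symmetric difference of two neighbourhoods. -/
noncomputable def sd (G : SimpleGraph V) (w v : V) : ℕ :=
  (Finset.univ.filter fun x => ¬ (G.Adj w x ↔ G.Adj v x)).card

/-- Replacing `w` by `u` increases the symmetric difference. -/
theorem sd_lt {w v u d : V} (hwv : G.Adj w v) (huw : G.Adj u w) (huv : G.Adj u v)
    (hd : ¬ (G.Adj u d ↔ G.Adj v d)) (hd' : G.Adj w d ↔ G.Adj v d) (hdu : d ≠ u)
    (hX : ∀ x, G.Adj w x → ¬ G.Adj v x → x ≠ v → G.Adj u x)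
    (hY : ∀ x, G.Adj v x → ¬ G.Adj w x → x ≠ w → ¬ G.Adj u x) :
    sd G w v < sd G u v := by
  classical
  unfold sd
  have hsub : insert d (insert u ((Finset.univ.filter fun x => ¬ (G.Adj w x ↔ G.Adj v x)).erase w))
      ⊆ Finset.univ.filter fun x => ¬ (G.Adj u x ↔ G.Adj v x) := by
    intro x hx
    simp only [Finset.mem_insert, Finset.mem_erase, Finset.mem_filter, Finset.mem_univ,
      true_and] at hx ⊢
    grind [G.adj_comm, G.irrefl]
  have hc := Finset.card_le_card hsub
  rw [Finset.card_insert_of_notMem, Finset.card_insert_of_notMem, Finset.card_erase_of_mem] at hc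
  · have : 0 < (Finset.univ.filter fun x => ¬ (G.Adj w x ↔ G.Adj v x)).card :=
      Finset.card_pos.mpr ⟨w, by simp [hwv.symm]⟩
    omega
  · simp [hwv.symm]
  · simp; grind [G.adj_comm, G.irrefl]
  · simp; grind [G.adj_comm, G.irrefl]

theorem sd_comm (w v : V) : sd G w v = sd G v w := by
  unfold sd
  congr 1
  ext x
  simp [iff_comm]

/-- If `u` is adjacent to both ends and splits the private neighbourhoods uniformly, the edge
was not optimal. -/
theorem improve {w v u d : V} (hwv : G.Adj w v) (hw : InP G w) (hv : InP G v) (hu : InP G u)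
    (huw : G.Adj u w) (huv : G.Adj u v) (hdu : d ≠ u)
    (hd' : G.Adj w d ↔ G.Adj v d) (hd : ¬ (G.Adj u d ↔ G.Adj v d))
    (hmax : ∀ w' v', G.Adj w' v' → InP G w' → InP G v' → sd G w' v' ≤ sd G w v)
    (m1 : ∀ x y, (G.Adj w x ∧ ¬ G.Adj v x ∧ x ≠ v) → (G.Adj v y ∧ ¬ G.Adj w y ∧ y ≠ w) →
      G.Adj u x → G.Adj u y → False)
    (m2 : ∀ x y, (G.Adj w x ∧ ¬ G.Adj v x ∧ x ≠ v) → (G.Adj v y ∧ ¬ G.Adj w y ∧ y ≠ w) →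
      ¬ G.Adj u x → ¬ G.Adj u y → False)
    (m3 : ∀ x y, (G.Adj w x ∧ ¬ G.Adj v x ∧ x ≠ v) → (G.Adj w y ∧ ¬ G.Adj v y ∧ y ≠ v) →
      G.Adj u x → ¬ G.Adj u y → False)
    (m4 : ∀ x y, (G.Adj v x ∧ ¬ G.Adj w x ∧ x ≠ w) → (G.Adj v y ∧ ¬ G.Adj w y ∧ y ≠ w) →
      G.Adj u x → ¬ G.Adj u y → False) : False := by
  rcases mixed_or m1 m2 m3 m4 with ⟨hX, hY⟩ | ⟨hX, hY⟩
  · have := sd_lt hwv huw huv hd hd' hdu (fun x a b c => hX x ⟨a, b, c⟩)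
      (fun x a b c => hY x ⟨a, b, c⟩)
    exact absurd (hmax u v huv hu hv) (not_le.mpr this)
  · have := sd_lt hwv.symm huv huw (by rwa [hd']) hd'.symm hdu (fun x a b c => hY x ⟨a, b, c⟩)
      (fun x a b c => hX x ⟨a, b, c⟩)
    rw [sd_comm v w] at this
    exact absurd (hmax u w huw hu hw) (not_le.mpr this)

end good

end S2T
namespace S2T

variable {V : Type*}

section exist
variable {G : SimpleGraph V} [Fintype V]

theorem exists_good (h1 : IsEmpty (twoK2 ↪g G)) (h2 : IsEmpty (cycle5 ↪g G))
    (h3 : IsEmpty (net ↪g G)) (h4 : IsEmpty (house ↪g G)) (h5 : IsEmpty (gem ↪g G))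
    (h6 : IsEmpty (octahedron ↪g G)) (h7 : IsEmpty (wheel4Pendant ↪g G))
    (h8 : IsEmpty (diamondPendants ↪g G)) {p q : V} (hpq : G.Adj p q) :
    ∃ w v, Good G w v := by
  classical
  obtain ⟨w0, hw0, hw0'⟩ := exists_inP_above h1 h2 h4 p
  obtain ⟨v0, hv0, hv0'⟩ := exists_inP_above h1 h2 h4 q
  have hwv0 : G.Adj v0 w0 := hv0' w0 (hw0' q hpq).symm
  obtain ⟨⟨w, v⟩, hm, hmax⟩ := (Finset.univ.filter fun e : V × V =>
    G.Adj e.1 e.2 ∧ InP G e.1 ∧ InP G e.2).exists_max_image (fun e => sd G e.1 e.2)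
      ⟨(v0, w0), by simp [hwv0, hw0, hv0]⟩
  simp only [Finset.mem_filter, Finset.mem_univ, true_and] at hm hmax
  obtain ⟨hwv, hw, hv⟩ := hm
  replace hmax : ∀ w' v', G.Adj w' v' → InP G w' → InP G v' → sd G w' v' ≤ sd G w v :=
    fun w' v' a b c => hmax (w', v') ⟨a, b, c⟩
  clear hw0 hw0' hv0 hv0' hwv0 hpq
  have sy : ∀ {a b : V}, G.Adj a b → G.Adj b a := fun h => h.symm
  have ns : ∀ {a b : V}, ¬ G.Adj a b → ¬ G.Adj b a := fun h h' => h h'.symm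
  refine ⟨w, v, hwv, hw, hv, ?_, ?_⟩
  · -- domination
    intro d hwd hvd u0 hdu0
    obtain ⟨u, hu, hu0⟩ := exists_inP_above h1 h2 h4 u0
    have hud : G.Adj u d := hu0 d hdu0.symm
    have huw : G.Adj u w := hu0 w (by
      by_contra hn
      exact hw d u0 hwd (ns hn) hdu0)
    have huv : G.Adj u v := hu0 v (by
      by_contra hn
      exact hv d u0 hvd (ns hn) hdu0)
    have hdX : ∀ x, ¬ G.Adj v x → ¬ G.Adj d x := fun x hx => hv d x hvd hx
    have hdY : ∀ x, ¬ G.Adj w x → ¬ G.Adj d x := fun x hx => hw d x hwd hx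
    refine improve (d := d) hwv hw hv hu huw huv hud.ne' (by tauto) (by tauto) hmax ?_ ?_ ?_ ?_
    · rintro x y ⟨hwx, hvx, hxv⟩ ⟨hvy, hwy, hyw⟩ hux huy
      by_cases hxy : G.Adj x y
      · exact no_wheel h7 x w v y u d hxv hyw.symm (sy hwx) hwv hvy (sy hxy) hux huw huv huy hud
          (ns hvx) hwy (hdX x hvx) (ns hwd) (ns hvd) (hdY y hwy)
      · exact no_gem h5 x w v y u (sy hwx) hwv hvy hux huw huv huy (ns hvx) hxy hwy
    · rintro x y ⟨hwx, hvx, hxv⟩ ⟨hvy, hwy, hyw⟩ hux huy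
      exact no_net h3 w v u x y d hwv (sy huv) (sy huw) hwx hvy hud hwy hwd hvx hvd hux huy
        (hu x y hux huy) (ns (hdX x hvx)) (ns (hdY y hwy))
    · rintro x y ⟨hwx, hvx, hxv⟩ ⟨hwy, hvy, hyv⟩ hux huy
      exact no_diamond h8 w u v x y d hxv.symm (sy huw) hwv hwx huv hux hwy hud hvx hwd huy
        hvy hvd (hv x y hvx hvy) (ns (hdX x hvx)) (ns (hdX y hvy))
    · rintro x y ⟨hvx, hwx, hxw⟩ ⟨hvy, hwy, hyw⟩ hux huy
      exact no_diamond h8 v u w x y d hxw.symm (sy huv) (sy hwv) hvx huw hux hvy hud hwx hvd huy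
        hwy hwd (hw x y hwx hwy) (ns (hdY x hwx)) (ns (hdY y hwy))
  · -- the common neighbours form a clique
    intro k0 l0 hwk0 hvk0 hwl0 hvl0 hne0
    by_contra hkl0
    obtain ⟨k, hk, hkmax⟩ := (Finset.univ.filter fun k : V => G.Adj w k ∧ G.Adj v k ∧
      ∃ l, G.Adj w l ∧ G.Adj v l ∧ k ≠ l ∧ ¬ G.Adj k l).exists_max_image
        (fun k => (G.neighborFinset k).card)
        ⟨k0, by simp only [Finset.mem_filter, Finset.mem_univ, true_and]
                exact ⟨hwk0, hvk0, l0, hwl0, hvl0, hne0, hkl0⟩⟩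
    simp only [Finset.mem_filter, Finset.mem_univ, true_and] at hk hkmax
    obtain ⟨hwk, hvk, l, hwl, hvl, hne, hkl⟩ := hk
    have hkP : InP G k := by
      by_contra hP
      obtain ⟨z, hkz, hz, t, hzt, hkt⟩ := dominated_of_not_inP h1 h2 h4 hP
      have hzk : z ≠ k := by
        rintro rfl
        exact hkt hzt
      have := hkmax z ⟨sy (hz w (sy hwk)), sy (hz v (sy hvk)), k, hwk, hvk, hzk, ns hkz⟩
      refine absurd this (not_le.mpr (Finset.card_lt_card ?_))
      refine Finset.ssubset_iff_subset_ne.mpr ⟨fun u => by simpa using hz u, fun he => hkt ?_⟩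
      have : t ∈ G.neighborFinset z := by simpa using hzt
      rw [← he] at this
      simpa using this
    refine improve (d := l) hwv hw hv hkP (sy hwk) (sy hvk) hne.symm (by tauto) (by tauto) hmax
      ?_ ?_ ?_ ?_
    · rintro x y ⟨hwx, hvx, hxv⟩ ⟨hvy, hwy, hyw⟩ hkx hky
      have hxy : G.Adj x y := by
        by_contra hxy
        exact no_gem h5 x w v y k (sy hwx) hwv hvy hkx (sy hwk) (sy hvk) hky (ns hvx) hxy hwy
      by_cases hlx : G.Adj l x <;> by_cases hly : G.Adj l y
      · exact no_octahedron h6 w y v x k l hyw.symm hxv.symm hne hwy hvx hkl hwv hwx hwk hwl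
          (sy hvy) (sy hxy) (sy hky) (sy hly) hvk hvl (sy hkx) (sy hlx)
      · exact no_gem h5 y k w l x (sy hky) (sy hwk) hwl hxy (sy hkx) (sy hwx) (sy hlx) (ns hwy)
          (ns hly) hkl
      · exact no_gem h5 x k v l y (sy hkx) (sy hvk) hvl (sy hxy) (sy hky) (sy hvy) (sy hly) (ns hvx)
          (ns hlx) hkl
      · exact no_house h4 w v y x l hwv hvy (sy hxy) (sy hwx) (sy hwl) (sy hvl) hwy hvx hly hlx
    · rintro x y ⟨hwx, hvx, hxv⟩ ⟨hvy, hwy, hyw⟩ hkx hky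
      have hxy : ¬ G.Adj x y := hkP x y hkx hky
      by_cases hlx : G.Adj l x
      · exact no_gem h5 k v l x w (sy hvk) hvl hlx hwk hwv hwl hwx hkl hkx hvx
      by_cases hly : G.Adj l y
      · exact no_gem h5 k w l y v (sy hwk) hwl hly hvk (sy hwv) hvl hvy hkl hky hwy
      exact no_diamond h8 w v k l x y hne hwv hwk hwl hvk hvl hwx hvy hkl hwy hvx hkx hky hlx hly
        hxy
    · rintro x y ⟨hwx, hvx, hxv⟩ ⟨hwy, hvy, hyv⟩ hkx hky
      have hlx : G.Adj l x := by
        by_contra hlx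
        exact no_gem h5 l v k x w (sy hvl) hvk hkx hwl hwv hwk hwx (ns hkl) hlx hvx
      have hly : ¬ G.Adj l y := fun hly =>
        no_gem h5 y l v k w (sy hly) (sy hvl) hvk hwy hwl hwv hwk (ns hvy) (ns hky) (ns hkl)
      exact no_wheel h7 v k x l w y hxv.symm hne hvk hkx (sy hlx) (sy hvl) hwv hwk hwx hwl hwy
        hvx hkl (ns hvy) (ns hky) (hv y x hvy hvx) (ns hly)
    · rintro x y ⟨hvx, hwx, hxw⟩ ⟨hvy, hwy, hyw⟩ hkx hky
      have hlx : G.Adj l x := by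
        by_contra hlx
        exact no_gem h5 l w k x v (sy hwl) hwk hkx hvl (sy hwv) hvk hvx (ns hkl) hlx hwx
      have hly : ¬ G.Adj l y := fun hly =>
        no_gem h5 y l w k v (sy hly) (sy hwl) hwk hvy hvl (sy hwv) hvk (ns hwy) (ns hky) (ns hkl)
      exact no_wheel h7 w k x l v y hxw.symm hne hwk hkx (sy hlx) (sy hwl) (sy hwv) hvk hvx hvl hvy
        hwx hkl (ns hwy) (ns hky) (hw y x hwy hwx) (ns hly)

end exist

/-! ### From a good edge to an ordering -/

section order

/-- A sortable multipartite tournament: no directed cycle of length three or four. -/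
theorem exists_rank [Fintype V] {ι : Type*} (part : V → ι) (R : V → V → Prop)
    (hpart : ∀ x y, R x y → part x ≠ part y)
    (hasym : ∀ x y, R x y → ¬ R y x)
    (htot : ∀ x y, part x ≠ part y → R x y ∨ R y x)
    (h3 : ∀ x y z, R x y → R y z → ¬ R z x)
    (h4 : ∀ x y z t, R x y → R y z → R z t → ¬ R t x) :
    ∃ f : V → ℕ, ∀ x y, R x y → f x < f y := by
  classical
  let T : V → V → Prop := fun x y => R x y ∨ ∃ z, R x z ∧ R z y
  have hirr : ∀ x, ¬ T x x := by
    rintro x (h | ⟨z, h, h'⟩)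
    · exact hasym x x h h
    · exact hasym _ _ h h'
  have hcomp : ∀ x y z, R x y → R y z → part x ≠ part z → R x z := by
    intro x y z h h' hp
    rcases htot x z hp with h'' | h''
    · exact h''
    · exact absurd h'' (h3 x y z h h')
  have hthree : ∀ x y z t, R x y → R y z → R z t → T x t := by
    intro x y z t a b c
    by_cases hxz : part x = part z
    · by_cases hyt : part y = part t
      · have hxt : part x ≠ part t := by
          rw [← hyt]
          exact hpart x y a
        rcases htot x t hxt with h | h
        · exact Or.inl h
        · exact absurd h (h4 x y z t a b c)
      · exact Or.inr ⟨y, a, hcomp y z t b c hyt⟩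
    · exact Or.inr ⟨z, hcomp x y z a b hxz, c⟩
  have hstep : ∀ x y z, T x y → R y z → T x z := by
    rintro x y z (h | ⟨t, h, h'⟩) h2
    · exact Or.inr ⟨y, h, h2⟩
    · exact hthree x t y z h h' h2
  refine ⟨fun x => (Finset.univ.filter fun y => T y x).card, fun x y hxy => ?_⟩
  refine Finset.card_lt_card (Finset.ssubset_iff_of_subset ?_ |>.mpr ⟨x, ?_, ?_⟩)
  · intro z hz
    simp only [Finset.mem_filter, Finset.mem_univ, true_and] at hz ⊢
    exact hstep z x y hz hxy
  · simp only [Finset.mem_filter, Finset.mem_univ, true_and]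
    exact Or.inl hxy
  · simp only [Finset.mem_filter, Finset.mem_univ, true_and]
    exact hirr x

theorem exists_enum [Fintype V] (f : V → ℕ) :
    ∃ (n : ℕ) (e : Fin n ≃ V), ∀ i j : Fin n, j < i → f (e j) ≤ f (e i) := by
  classical
  let e0 := (Fintype.equivFin V).symm
  refine ⟨_, (Tuple.sort (f ∘ e0)).trans e0, fun i j hji => ?_⟩
  exact Tuple.monotone_sort (f ∘ e0) hji.le

variable {G : SimpleGraph V}

open Classical in
/-- The three classes: `0` for non-neighbours of `w`, `1` for common neighbours, `2` for the rest. -/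
noncomputable def cls (G : SimpleGraph V) (w v : V) (x : V) : Fin 3 :=
  if G.Adj w x then (if G.Adj v x then 1 else 2) else 0

/-- The forced order between vertices of different classes. -/
def before (G : SimpleGraph V) (p : V → Fin 3) (x y : V) : Prop :=
  (p x < p y ∧ G.Adj x y) ∨ (p y < p x ∧ ¬ G.Adj x y)

theorem special_of_good [Fintype V] (h1 : IsEmpty (twoK2 ↪g G))
    (h4 : IsEmpty (house ↪g G)) (h5 : IsEmpty (gem ↪g G)) {w v : V} (hg : Good G w v) :
    IsSpecial2Threshold G := by
  classical
  obtain ⟨hwv, hw, hv, hdom, hcl⟩ := hg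
  have sy : ∀ {a b : V}, G.Adj a b → G.Adj b a := fun h => h.symm
  have ns : ∀ {a b : V}, ¬ G.Adj a b → ¬ G.Adj b a := fun h h' => h h'.symm
  obtain ⟨p, hp⟩ : ∃ p, p = cls G w v := ⟨_, rfl⟩
  have p0 : ∀ x, p x = 0 ↔ ¬ G.Adj w x := by
    intro x; subst hp; unfold cls; split_ifs <;> simp [*]
  have p1 : ∀ x, p x = 1 ↔ G.Adj w x ∧ G.Adj v x := by
    intro x; subst hp; unfold cls; split_ifs <;> simp [*]
  have p2 : ∀ x, p x = 2 ↔ G.Adj w x ∧ ¬ G.Adj v x := by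
    intro x; subst hp; unfold cls; split_ifs <;> simp [*]
  -- a class-zero vertex with a neighbour is adjacent to `v`
  have hAv : ∀ a u, p a = 0 → G.Adj a u → G.Adj v a := by
    intro a u ha hau
    by_contra hn
    exact hdom a ((p0 a).mp ha) hn u hau
  have t1 : ∀ a k b, p a = 0 → p k = 1 → p b = 2 → G.Adj a k → G.Adj k b → G.Adj a b := by
    intro a k b ha hk hb hak hkb
    by_contra hab
    have hva := hAv a k ha hak
    rw [p0] at ha
    rw [p1] at hk
    rw [p2] at hb
    exact no_gem h5 a v w b k (sy hva) (sy hwv) hb.1 (sy hak) (sy hk.2) (sy hk.1) hkb (ns ha) hab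
      hb.2
  have t2 : ∀ a k b, p a = 0 → p k = 1 → p b = 2 → ¬ G.Adj a k → ¬ G.Adj k b → ¬ G.Adj a b := by
    intro a k b ha hk hb hak hkb hab
    have hva := hAv a b ha hab
    rw [p0] at ha
    rw [p1] at hk
    rw [p2] at hb
    exact no_house h4 v w b a k (sy hwv) hb.1 (sy hab) (sy hva) (sy hk.2) (sy hk.1) hb.2 ha
      hkb (ns hak)
  have ak : ∀ a a' k k', p a = 0 → p a' = 0 → p k = 1 → p k' = 1 → G.Adj a k → G.Adj a' k' →
      ¬ G.Adj a k' → ¬ G.Adj a' k → False := by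
    intro a a' k k' ha ha' hk hk' h h' n n'
    have hva := hAv a k ha h
    have hva' := hAv a' k' ha' h'
    rw [p0] at ha ha'
    rw [p1] at hk hk'
    have hkk : k ≠ k' := by rintro rfl; exact n h
    exact no_gem h5 a k k' a' v h (hcl k k' hk.1 hk.2 hk'.1 hk'.2 hkk) (sy h') hva hk.2 hk'.2 hva'
      n (hw a a' ha ha') (ns n')
  have bk : ∀ a a' k k', p a = 2 → p a' = 2 → p k = 1 → p k' = 1 → G.Adj a k → G.Adj a' k' →
      ¬ G.Adj a k' → ¬ G.Adj a' k → False := by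
    intro a a' k k' ha ha' hk hk' h h' n n'
    rw [p2] at ha ha'
    rw [p1] at hk hk'
    have hkk : k ≠ k' := by rintro rfl; exact n h
    exact no_gem h5 a k k' a' w h (hcl k k' hk.1 hk.2 hk'.1 hk'.2 hkk) (sy h') ha.1 hk.1 hk'.1 ha'.1
      n (hv a a' ha.2 ha'.2) (ns n')
  have ab : ∀ a a' k k', p a = 0 → p a' = 0 → p k = 2 → p k' = 2 → G.Adj a k → G.Adj a' k' →
      ¬ G.Adj a k' → ¬ G.Adj a' k → False := by
    intro a a' k k' ha ha' hk hk' h h' n n'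
    rw [p0] at ha ha'
    rw [p2] at hk hk'
    exact no_twoK2 h1 a k a' k' h h' (hw a a' ha ha') n (ns n') (hv k k' hk.2 hk'.2)
  have i0 : ∀ x y, p x = 0 → p y = 0 → ¬ G.Adj x y := fun x y hx hy =>
    hw x y ((p0 x).mp hx) ((p0 y).mp hy)
  have i2 : ∀ x y, p x = 2 → p y = 2 → ¬ G.Adj x y := fun x y hx hy =>
    hv x y ((p2 x).mp hx).2 ((p2 y).mp hy).2
  have c1 : ∀ x y, p x = 1 → p y = 1 → x ≠ y → G.Adj x y := fun x y hx hy =>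
    hcl x y ((p1 x).mp hx).1 ((p1 x).mp hx).2 ((p1 y).mp hy).1 ((p1 y).mp hy).2
  have cases3 : ∀ x, p x = 0 ∨ p x = 1 ∨ p x = 2 := by
    intro x
    generalize p x = q
    revert q
    decide
  clear p0 p1 p2 hAv hp hw hv hdom hcl hwv
  have htot : ∀ x y, p x ≠ p y → before G p x y ∨ before G p y x := by
    intro x y h
    unfold before
    rw [G.adj_comm y x]
    rcases lt_or_gt_of_ne h with h | h <;> by_cases h' : G.Adj x y <;> simp [h, h']
  have hR3 : ∀ x y z, before G p x y → before G p y z → ¬ before G p z x := by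
    intro x y z hxy hyz hzx
    unfold before at hxy hyz hzx
    rcases cases3 x with hx | hx | hx <;> rcases cases3 y with hy | hy | hy <;>
      rcases cases3 z with hz | hz | hz <;> simp [hx, hy, hz] at hxy hyz hzx <;>
      grind [G.adj_comm]
  have hR4 : ∀ x y z t, before G p x y → before G p y z → before G p z t → ¬ before G p t x := by
    intro x y z t hxy hyz hzt htx
    have hxz : p x = p z := by
      by_contra hne
      rcases htot x z hne with h | h
      · exact hR3 x z t h hzt htx
      · exact hR3 x y z hxy hyz h
    have hyt : p y = p t := by
      by_contra hne
      rcases htot y t hne with h | h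
      · exact hR3 y t x h htx hxy
      · exact hR3 y z t hyz hzt h
    unfold before at hxy hyz hzt htx
    rcases cases3 x with hx | hx | hx <;> rcases cases3 y with hy | hy | hy <;>
      simp [← hxz, ← hyt, hx, hy] at hxy hyz hzt htx <;>
      grind [G.adj_comm]
  obtain ⟨f, hf⟩ := exists_rank p (before G p)
    (by rintro x y (⟨h, -⟩ | ⟨h, -⟩)
        · exact h.ne
        · exact h.ne')
    (by rintro x y (⟨h, h'⟩ | ⟨h, h'⟩) (⟨g, g'⟩ | ⟨g, g'⟩)
        · exact lt_asymm h g
        · exact g' (sy h')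
        · exact h' (sy g')
        · exact lt_asymm h g)
    htot hR3 hR4
  obtain ⟨n, e, he⟩ := exists_enum f
  refine ⟨n, e, fun x => decide (p x ≠ 2), fun i => ?_⟩
  have key : ∀ j, j < i → ¬ before G p (e i) (e j) := fun j hj hb =>
    absurd (hf _ _ hb) (not_lt.mpr (he i j hj))
  have ne : ∀ j, j < i → e i ≠ e j := fun j hj h => hj.ne' (e.injective h)
  rcases cases3 (e i) with hi | hi | hi
  · left
    intro j hj hadj
    have hk := key j hj
    rcases cases3 (e j) with hj' | hj' | hj'
    · exact i0 _ _ hi hj' hadj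
    · exact hk (Or.inl ⟨by rw [hi, hj']; decide, hadj⟩)
    · exact hk (Or.inl ⟨by rw [hi, hj']; decide, hadj⟩)
  · right
    intro j hj
    have hk := key j hj
    rcases cases3 (e j) with hj' | hj' | hj'
    · simp only [hj']
      simp only [before, hi, hj'] at hk
      simpa using hk
    · simpa [hj'] using c1 _ _ hi hj' (ne j hj)
    · simp only [hj']
      simp only [before, hi, hj'] at hk
      simpa using hk
  · right
    intro j hj
    have hk := key j hj
    rcases cases3 (e j) with hj' | hj' | hj'
    · simp only [hj']
      simp only [before, hi, hj'] at hk
      simpa using hk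
    · simp only [hj']
      simp only [before, hi, hj'] at hk
      simpa using hk
    · simpa [hj'] using i2 _ _ hi hj'

end order

end S2T
namespace S2T

theorem stuck_twoK2 : Stuck twoK2 := by
  refine stuck_of_list [[0, 1, 2, 3], [0, 1], [2, 3]] ?_
  unfold twoK2
  decide +kernel

theorem stuck_cycle5 : Stuck cycle5 := by
  refine stuck_of_list [[0, 1, 2, 3, 4], [0, 1, 2], [0, 3, 4], [2, 3]] ?_
  unfold cycle5
  decide +kernel

theorem stuck_house : Stuck house := by
  refine stuck_of_list [[0, 1, 2, 3, 4], [0, 1, 4], [2, 3], [0, 2, 3, 4], [1, 2, 3, 4]] ?_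
  unfold house
  decide +kernel

theorem stuck_gem : Stuck gem := by
  refine stuck_of_list [[0, 1, 2, 3, 4], [0, 1], [2, 3], [0, 1, 2, 3], [0, 1, 3, 4], [0, 2, 3, 4]] ?_
  unfold gem
  decide +kernel

theorem stuck_net : Stuck net := by
  refine stuck_of_list [[0, 1, 2, 3, 4, 5], [0, 1, 2], [0, 1, 3, 4], [0, 2, 3, 5], [1, 2, 4, 5]] ?_
  unfold net
  decide +kernel

theorem stuck_octahedron : Stuck octahedron := by
  refine stuck_of_list [[0, 1, 2, 3, 4, 5], [0, 1, 2, 3], [0, 1, 4, 5], [2, 3, 4, 5]] ?_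
  unfold octahedron
  decide +kernel

theorem stuck_wheel : Stuck wheel4Pendant := by
  refine stuck_of_list [[0, 1, 2, 3, 4, 5], [0, 1, 2, 3], [0, 2, 4, 5], [1, 3, 4, 5]] ?_
  unfold wheel4Pendant
  decide +kernel

theorem stuck_diamond : Stuck diamondPendants := by
  refine stuck_of_list [[0, 1, 2, 3, 4, 5], [0, 1, 2], [0, 1, 4, 5], [0, 2, 3, 4], [1, 2, 3, 5]] ?_
  unfold diamondPendants
  decide +kernel

end S2T

/-- A graph is a special 2-threshold graph iff it has no induced `2K₂`, `C₅`, net, house,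
gem, octahedron, 4-wheel with a pendant vertex attached to its center, or diamond with a
pendant vertex attached to each of its degree-three vertices. -/
theorem special2Threshold_iff_forbidden {V : Type*} [Fintype V] (G : SimpleGraph V) :
    IsSpecial2Threshold G ↔
      (IsEmpty (twoK2 ↪g G) ∧ IsEmpty (cycle5 ↪g G) ∧ IsEmpty (net ↪g G) ∧
       IsEmpty (house ↪g G) ∧ IsEmpty (gem ↪g G) ∧ IsEmpty (octahedron ↪g G) ∧
       IsEmpty (wheel4Pendant ↪g G) ∧ IsEmpty (diamondPendants ↪g G)) := by
  classical
  constructor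
  · intro h
    exact ⟨S2T.isEmpty_of_stuck S2T.stuck_twoK2 h, S2T.isEmpty_of_stuck S2T.stuck_cycle5 h,
      S2T.isEmpty_of_stuck S2T.stuck_net h, S2T.isEmpty_of_stuck S2T.stuck_house h,
      S2T.isEmpty_of_stuck S2T.stuck_gem h, S2T.isEmpty_of_stuck S2T.stuck_octahedron h,
      S2T.isEmpty_of_stuck S2T.stuck_wheel h, S2T.isEmpty_of_stuck S2T.stuck_diamond h⟩
  · rintro ⟨h1, h2, h3, h4, h5, h6, h7, h8⟩
    by_cases hE : ∃ p q, G.Adj p q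
    · obtain ⟨p, q, hpq⟩ := hE
      obtain ⟨w, v, hg⟩ := S2T.exists_good h1 h2 h3 h4 h5 h6 h7 h8 hpq
      exact S2T.special_of_good h1 h4 h5 hg
    · push Not at hE
      exact ⟨_, (Fintype.equivFin V).symm, fun _ => true, fun i => Or.inl fun j _ => hE _ _⟩
end

section
/- A 2-threshold graph has at most two connected components containing at least two vertices. -/
/-- `G` is a 2-threshold graph: there is a black-and-white coloring (white = `true`) such
that every nonempty vertex subset `W` contains a vertex `x` which is isolated in `W`, or
whose neighbors inside `W` are exactly the white vertices of `W \ {x}`, or exactly the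
black vertices of `W \ {x}`. -/
def Is2Threshold {V : Type*} (G : SimpleGraph V) : Prop :=
  ∃ c : V → Bool, ∀ W : Set V, W.Nonempty → ∃ x ∈ W,
    (∀ y ∈ W, ¬ G.Adj x y) ∨
    (∀ y ∈ W, y ≠ x → (G.Adj x y ↔ c y = true)) ∨
    (∀ y ∈ W, y ≠ x → (G.Adj x y ↔ c y = false))

lemma exists_adj_of_nontrivial {V : Type*} (G : SimpleGraph V) (C : G.ConnectedComponent)
    (h : C.supp.Nontrivial) : ∃ a b, G.Adj a b ∧
      G.connectedComponentMk a = C ∧ G.connectedComponentMk b = C := by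
  obtain ⟨a, ha, b, hb, hab⟩ := h
  rw [SimpleGraph.ConnectedComponent.mem_supp_iff] at ha hb
  obtain ⟨p⟩ := SimpleGraph.ConnectedComponent.exact (ha.trans hb.symm)
  cases p with
  | nil => exact absurd rfl hab
  | cons e q =>
    exact ⟨_, _, e, ha, (SimpleGraph.ConnectedComponent.sound e.reachable).symm.trans ha⟩

/-- Two edges in different components cannot be monochromatic of the same color. -/
lemma not_mono {V : Type*} (G : SimpleGraph V) (c : V → Bool)
    (hc : ∀ W : Set V, W.Nonempty → ∃ x ∈ W,
      (∀ y ∈ W, ¬ G.Adj x y) ∨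
      (∀ y ∈ W, y ≠ x → (G.Adj x y ↔ c y = true)) ∨
      (∀ y ∈ W, y ≠ x → (G.Adj x y ↔ c y = false)))
    (k : V → G.ConnectedComponent) (hk : ∀ x y, G.Adj x y → k x = k y)
    (a b a' b' : V) (e : G.Adj a b) (e' : G.Adj a' b') (hne : k a ≠ k a')
    (h1 : c a = c b) (h2 : c a = c a') (h3 : c a = c b') : False := by
  have hs := e.symm
  have hs' := e'.symm
  have n := e.ne
  have n' := e'.ne
  have ke := hk _ _ e
  have ke' := hk _ _ e'
  obtain ⟨x, hx, h⟩ := hc {a, b, a', b'} ⟨a, by simp⟩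
  simp only [Set.mem_insert_iff, Set.mem_singleton_iff, forall_eq_or_imp, forall_eq] at hx h
  rcases hx with rfl | rfl | rfl | rfl <;> grind +splitImp

/-- A 2-threshold graph has at most two connected components containing at least two
vertices: among any three connected components whose supports are nontrivial, two
coincide. -/
theorem twoThreshold_at_most_two_nontrivial_components {V : Type*} [Fintype V]
    (G : SimpleGraph V) (h : Is2Threshold G)
    (C₁ C₂ C₃ : G.ConnectedComponent)
    (h₁ : C₁.supp.Nontrivial) (h₂ : C₂.supp.Nontrivial) (h₃ : C₃.supp.Nontrivial) :
    C₁ = C₂ ∨ C₁ = C₃ ∨ C₂ = C₃ := by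
  obtain ⟨c, hc⟩ := h
  obtain ⟨a₁, b₁, e₁, p₁, q₁⟩ := exists_adj_of_nontrivial G C₁ h₁
  obtain ⟨a₂, b₂, e₂, p₂, q₂⟩ := exists_adj_of_nontrivial G C₂ h₂
  obtain ⟨a₃, b₃, e₃, p₃, q₃⟩ := exists_adj_of_nontrivial G C₃ h₃
  by_contra! hne
  obtain ⟨n12, n13, n23⟩ := hne
  have hk : ∀ x y, G.Adj x y → G.connectedComponentMk x = G.connectedComponentMk y :=
    fun x y e => SimpleGraph.ConnectedComponent.sound e.reachable
  have m := not_mono G c hc G.connectedComponentMk hk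
  have m12 := m a₁ b₁ a₂ b₂ e₁ e₂ (by rw [p₁, p₂]; exact n12)
  have m13 := m a₁ b₁ a₃ b₃ e₁ e₃ (by rw [p₁, p₃]; exact n13)
  have m23 := m a₂ b₂ a₃ b₃ e₂ e₃ (by rw [p₂, p₃]; exact n23)
  have s₁ := e₁.symm
  have s₂ := e₂.symm
  have s₃ := e₃.symm
  obtain ⟨x, hx, h⟩ := hc {a₁, b₁, a₂, b₂, a₃, b₃} ⟨a₁, by simp⟩
  clear hc m
  simp only [Set.mem_insert_iff, Set.mem_singleton_iff, forall_eq_or_imp, forall_eq] at hx h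
  rcases hx with rfl | rfl | rfl | rfl | rfl | rfl <;> grind +splitImp
end

section
/- A finite simple graph G = (V,E) is switching equivalent to a threshold graph if and only if G has no induced subgraph which is switching equivalent to 3K2, to C5, or to C4 + 2K1. Precisely: there exists S ⊆ V such that the switch of G with respect to S is a threshold graph if and only if there is no vertex subset W ⊆ V and no set T ⊆ W such that the switch of the subgraph of G induced on W with respect to T is isomorphic to 3K2, to C5, or to C4 + 2K1. -/
/-- `G` is a threshold graph: every nonempty induced subgraph (given by a nonempty vertex
subset `W`) has a vertex that is isolated in it or universal in it. -/
def IsThreshold {V : Type*} (G : SimpleGraph V) : Prop :=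
  ∀ W : Set V, W.Nonempty → ∃ x ∈ W,
    (∀ y ∈ W, ¬ G.Adj x y) ∨ (∀ y ∈ W, y ≠ x → G.Adj x y)

/-- The switch of `G` with respect to `S`: distinct vertices `u, v` are adjacent iff
either they are adjacent in `G` and both in `S` or both outside `S`, or they are
nonadjacent in `G` and exactly one of them is in `S`. -/
def switch {V : Type*} (G : SimpleGraph V) (S : Set V) : SimpleGraph V :=
  SimpleGraph.fromRel (fun u v =>
    (G.Adj u v ∧ ((u ∈ S ∧ v ∈ S) ∨ (u ∉ S ∧ v ∉ S))) ∨
    (¬ G.Adj u v ∧ Xor' (u ∈ S) (v ∈ S)))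

/-- `3K₂`: the disjoint union of three edges. -/
def threeK2 : SimpleGraph (Fin 6) := graphOfEdges 6 [(0, 1), (2, 3), (4, 5)]

/-- `C₄ + 2K₁`: a 4-cycle `0,1,2,3` together with two isolated vertices `4, 5`. -/
def c4TwoK1 : SimpleGraph (Fin 6) := graphOfEdges 6 [(0, 1), (1, 2), (2, 3), (3, 0)]

theorem switch_adj {V : Type*} (G : SimpleGraph V) (S : Set V) (u v : V) :
    (switch G S).Adj u v ↔ u ≠ v ∧ (G.Adj u v ↔ (u ∈ S ↔ v ∈ S)) := by
  unfold switch
  rw [SimpleGraph.fromRel_adj]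
  have := G.adj_comm u v
  by_cases hu : u ∈ S <;> by_cases hv : v ∈ S <;> simp [hu, hv, Xor', Xor] <;> tauto

theorem switch_switch {V : Type*} (G : SimpleGraph V) (S T : Set V) :
    switch (switch G S) T = switch G {v | ¬ (v ∈ S ↔ v ∈ T)} := by
  ext u v
  simp only [switch_adj, Set.mem_ofPred_eq]
  tauto

/-- No alternating 4-cycle inside `s`. -/
def AltFree {V : Type*} (K : SimpleGraph V) (s : Set V) : Prop :=
  ∀ a ∈ s, ∀ b ∈ s, ∀ c ∈ s, ∀ d ∈ s, K.Adj a b → K.Adj c d → b ≠ c → a ≠ d →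
    ¬ K.Adj b c → ¬ K.Adj a d → False

theorem IsThreshold.altFree {V : Type*} {K : SimpleGraph V} (h : IsThreshold K) (s : Set V) :
    AltFree K s := by
  intro a _ b _ c _ d _ h1 h2 h3 h4 h5 h6
  obtain ⟨x, hx, h⟩ := h {a, b, c, d} ⟨a, by simp⟩
  have e1 := h1.symm
  have e2 := h2.symm
  have e5 : ¬ K.Adj c b := fun h => h5 h.symm
  have e6 : ¬ K.Adj d a := fun h => h6 h.symm
  simp only [Set.mem_insert_iff, Set.mem_singleton_iff] at hx h
  rcases h with h | h
  · have ha := h a (by simp)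
    have hb := h b (by simp)
    have hc := h c (by simp)
    have hd := h d (by simp)
    rcases hx with rfl | rfl | rfl | rfl <;> contradiction
  · have ha := h a (by simp)
    have hb := h b (by simp)
    have hc := h c (by simp)
    have hd := h d (by simp)
    rcases hx with rfl | rfl | rfl | rfl
    · exact h6 (hd h4.symm)
    · exact h5 (hc h3.symm)
    · exact e5 (hb h3)
    · exact e6 (ha h4)

theorem AltFree.exists_vertex {V : Type*} {K : SimpleGraph V} [Fintype V] {s : Set V}
    (h : AltFree K s) (hs : s.Nonempty) :
    ∃ x ∈ s, (∀ y ∈ s, ¬ K.Adj x y) ∨ (∀ y ∈ s, y ≠ x → K.Adj x y) := by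
  classical
  obtain ⟨x, hx, hmax⟩ := s.toFinset.exists_max_image
    (fun x => (s.toFinset.filter (fun y => K.Adj x y)).card) (by simpa using hs)
  simp only [Set.mem_toFinset] at hx hmax
  by_cases hu : ∀ y ∈ s, y ≠ x → K.Adj x y
  · exact ⟨x, hx, Or.inr hu⟩
  push Not at hu
  obtain ⟨z, hz, hzx, hxz⟩ := hu
  refine ⟨z, hz, Or.inl fun w hw hzw => ?_⟩
  -- some neighbour of `x` is not a neighbour of `w`
  have hwx : w ≠ x := by rintro rfl; exact hxz hzw.symm
  have key : ∃ y ∈ s, K.Adj x y ∧ y ≠ w ∧ ¬ K.Adj w y := by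
    by_contra hcon
    push Not at hcon
    have hle := hmax w hw
    set A := s.toFinset.filter (fun y => K.Adj x y) with hA
    set B := s.toFinset.filter (fun y => K.Adj w y) with hB
    have hsub : A.erase w ⊆ (B.erase x).erase z := by
      intro y hy
      simp only [hA, hB, Finset.mem_erase, Finset.mem_filter, Set.mem_toFinset] at hy ⊢
      refine ⟨?_, ?_, hy.2.1, hcon y hy.2.1 hy.2.2 hy.1⟩
      · rintro rfl; exact hxz hy.2.2
      · rintro rfl; exact K.loopless.irrefl _ hy.2.2
    have hc := Finset.card_le_card hsub
    have hzB : z ∈ B.erase x := by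
      simp only [hB, Finset.mem_erase, Finset.mem_filter, Set.mem_toFinset]
      exact ⟨hzx, hz, hzw.symm⟩
    have h1 := Finset.card_erase_of_mem hzB
    have hp : 0 < (B.erase x).card := Finset.card_pos.mpr ⟨z, hzB⟩
    by_cases hadj : K.Adj x w
    · have hwA : w ∈ A := by simp [hA, hw, hadj]
      have hxB : x ∈ B := by simp [hB, hx, hadj.symm]
      have h2 := Finset.card_erase_of_mem hwA
      have h3 := Finset.card_erase_of_mem hxB
      have : 0 < A.card := Finset.card_pos.mpr ⟨w, hwA⟩
      omega
    · have hwA : w ∉ A := by simp [hA, hadj]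
      have hxB : x ∉ B := by simp [hB, K.adj_comm w x, hadj]
      have h2 := Finset.erase_eq_of_notMem hwA
      have h3 := Finset.erase_eq_of_notMem hxB
      rw [h2] at hc
      rw [h3] at hc h1 hp
      omega
  obtain ⟨y, hy, hxy, hyw, hwy⟩ := key
  exact h z hz w hw y hy x hx hzw hxy.symm hyw.symm hzx hwy (fun h => hxz h.symm)

theorem AltFree.isThreshold {V : Type*} [Fintype V] {K : SimpleGraph V}
    (h : AltFree K Set.univ) : IsThreshold K := by
  intro W hW
  refine AltFree.exists_vertex ?_ hW
  intro a _ b _ c _ d _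
  exact h a trivial b trivial c trivial d trivial

/-- No switch of `G` contains one of the three forbidden graphs. -/
structure NoObs {V : Type*} (G : SimpleGraph V) : Prop where
  threeK2 : ∀ (S : Set V) (f : Fin 6 → V), Function.Injective f →
    (∀ i j, (switch G S).Adj (f i) (f j) ↔ threeK2.Adj i j) → False
  cycle5 : ∀ (S : Set V) (f : Fin 5 → V), Function.Injective f →
    (∀ i j, (switch G S).Adj (f i) (f j) ↔ cycle5.Adj i j) → False
  c4TwoK1 : ∀ (S : Set V) (f : Fin 6 → V), Function.Injective f →
    (∀ i j, (switch G S).Adj (f i) (f j) ↔ c4TwoK1.Adj i j) → False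

theorem NoObs.switch {V : Type*} {G : SimpleGraph V} (h : NoObs G) (S : Set V) :
    NoObs (switch G S) := by
  constructor
  · intro T f; rw [switch_switch]; exact h.threeK2 _ f
  · intro T f; rw [switch_switch]; exact h.cycle5 _ f
  · intro T f; rw [switch_switch]; exact h.c4TwoK1 _ f

theorem exists_iso {V : Type*} {n : ℕ} {G : SimpleGraph V} {F : SimpleGraph (Fin n)}
    (S : Set V) (f : Fin n → V) (hf : Function.Injective f)
    (h : ∀ i j, (switch G S).Adj (f i) (f j) ↔ F.Adj i j) :
    ∃ (W : Set V) (T : Set W), Nonempty (switch (G.induce W) T ≃g F) := by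
  refine ⟨Set.range f, Subtype.val ⁻¹' S, ⟨RelIso.symm ⟨Equiv.ofInjective f hf, ?_⟩⟩⟩
  intro i j
  rw [← h i j]
  simp only [switch_adj, SimpleGraph.comap_adj, Set.mem_preimage, ne_eq, Subtype.ext_iff,
    Equiv.ofInjective_apply, Function.Embedding.subtype_apply]

theorem NoObs.no_p4 {V : Type*} {K : SimpleGraph V} (h : NoObs K) {x p q r t : V}
    (hx : ∀ y, ¬ K.Adj x y) (h1 : K.Adj p q) (h2 : K.Adj q r) (h3 : K.Adj r t)
    (h4 : ¬ K.Adj p r) (h5 : ¬ K.Adj q t) (h6 : ¬ K.Adj p t) (h7 : p ≠ t) : False := by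
  have hx' : ∀ y, ¬ K.Adj y x := fun y hy => hx y hy.symm
  have a1 : x ≠ p := by rintro rfl; exact hx _ h1
  have a2 : x ≠ q := by rintro rfl; exact hx _ h2
  have a3 : x ≠ r := by rintro rfl; exact hx _ h3
  have a4 : x ≠ t := by rintro rfl; exact hx _ h3.symm
  have a5 : p ≠ q := h1.ne
  have a6 : p ≠ r := by rintro rfl; exact h6 h3
  have a7 : q ≠ r := h2.ne
  have a8 : q ≠ t := by rintro rfl; exact h6 h1
  have a9 : r ≠ t := h3.ne
  refine h.cycle5 {p, t} ![x, p, r, q, t] ?_ ?_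
  · intro i j hij
    fin_cases i <;> fin_cases j <;> simp_all
  · intro i j
    have := h1.symm; have := h2.symm; have := h3.symm
    have : ¬ K.Adj r p := fun h => h4 h.symm
    have : ¬ K.Adj t q := fun h => h5 h.symm
    have : ¬ K.Adj t p := fun h => h6 h.symm
    have := a1.symm; have := a2.symm; have := a3.symm; have := a4.symm; have := a5.symm
    have := a6.symm; have := a7.symm; have := a8.symm; have := a9.symm; have := h7.symm
    fin_cases i <;> fin_cases j <;>
      simp_all [switch_adj, _root_.cycle5, graphOfEdges]

theorem NoObs.no_butterfly {V : Type*} {K : SimpleGraph V} (h : NoObs K) {x y p q c d : V}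
    (hx : ∀ y, ¬ K.Adj x y) (h1 : K.Adj p q) (h2 : K.Adj c d)
    (n1 : ¬ K.Adj p c) (n2 : ¬ K.Adj p d) (n3 : ¬ K.Adj q c) (n4 : ¬ K.Adj q d)
    (y1 : K.Adj y p) (y2 : K.Adj y q) (y3 : K.Adj y c) (y4 : K.Adj y d) : False := by
  have hx' : ∀ y, ¬ K.Adj y x := fun y hy => hx y hy.symm
  have a1 : x ≠ p := by rintro rfl; exact hx _ h1
  have a2 : x ≠ q := by rintro rfl; exact hx _ h1.symm
  have a3 : x ≠ c := by rintro rfl; exact hx _ h2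
  have a4 : x ≠ d := by rintro rfl; exact hx _ h2.symm
  have a5 : x ≠ y := by rintro rfl; exact hx _ y1
  have a6 : p ≠ q := h1.ne
  have a7 : c ≠ d := h2.ne
  have a8 : p ≠ c := by rintro rfl; exact n2 h2
  have a9 : p ≠ d := by rintro rfl; exact n1 h2.symm
  have b1 : q ≠ c := by rintro rfl; exact n4 h2
  have b2 : q ≠ d := by rintro rfl; exact n3 h2.symm
  have b3 := y1.ne
  have b4 := y2.ne
  have b5 := y3.ne
  have b6 := y4.ne
  refine h.threeK2 {y} ![x, y, p, q, c, d] ?_ ?_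
  · intro i j hij
    fin_cases i <;> fin_cases j <;> simp_all
  · intro i j
    have := h1.symm; have := h2.symm
    have := y1.symm; have := y2.symm; have := y3.symm; have := y4.symm
    have : ¬ K.Adj c p := fun h => n1 h.symm
    have : ¬ K.Adj d p := fun h => n2 h.symm
    have : ¬ K.Adj c q := fun h => n3 h.symm
    have : ¬ K.Adj d q := fun h => n4 h.symm
    have := a1.symm; have := a2.symm; have := a3.symm; have := a4.symm; have := a5.symm
    have := a6.symm; have := a7.symm; have := a8.symm; have := a9.symm; have := b1.symm
    have := b2.symm; have := b3.symm; have := b4.symm; have := b5.symm; have := b6.symm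
    fin_cases i <;> fin_cases j <;>
      simp_all [switch_adj, _root_.threeK2, graphOfEdges]

/-- `p c q d` is a 4-cycle and `y` is isolated from it. -/
theorem NoObs.no_c4 {V : Type*} {K : SimpleGraph V} (h : NoObs K) {x y p q c d : V}
    (hx : ∀ y, ¬ K.Adj x y) (h1 : ¬ K.Adj p q) (h2 : ¬ K.Adj c d) (a6 : p ≠ q) (a7 : c ≠ d)
    (n1 : K.Adj p c) (n2 : K.Adj p d) (n3 : K.Adj q c) (n4 : K.Adj q d) (hxy : x ≠ y)
    (y1 : ¬ K.Adj y p) (y2 : ¬ K.Adj y q) (y3 : ¬ K.Adj y c) (y4 : ¬ K.Adj y d) : False := by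
  have hx' : ∀ y, ¬ K.Adj y x := fun y hy => hx y hy.symm
  have a1 : x ≠ p := by rintro rfl; exact hx _ n1
  have a2 : x ≠ q := by rintro rfl; exact hx _ n3
  have a3 : x ≠ c := by rintro rfl; exact hx _ n1.symm
  have a4 : x ≠ d := by rintro rfl; exact hx _ n2.symm
  have a8 : p ≠ c := n1.ne
  have a9 : p ≠ d := n2.ne
  have b1 : q ≠ c := n3.ne
  have b2 : q ≠ d := n4.ne
  have b3 : y ≠ p := by rintro rfl; exact y3 n1
  have b4 : y ≠ q := by rintro rfl; exact y3 n3
  have b5 : y ≠ c := by rintro rfl; exact y1 n1.symm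
  have b6 : y ≠ d := by rintro rfl; exact y1 n2.symm
  refine h.c4TwoK1 ∅ ![p, c, q, d, x, y] ?_ ?_
  · intro i j hij
    fin_cases i <;> fin_cases j <;> simp_all
  · intro i j
    have := n1.symm; have := n2.symm; have := n3.symm; have := n4.symm
    have : ¬ K.Adj q p := fun h => h1 h.symm
    have : ¬ K.Adj d c := fun h => h2 h.symm
    have : ¬ K.Adj p y := fun h => y1 h.symm
    have : ¬ K.Adj q y := fun h => y2 h.symm
    have : ¬ K.Adj c y := fun h => y3 h.symm
    have : ¬ K.Adj d y := fun h => y4 h.symm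
    have := a1.symm; have := a2.symm; have := a3.symm; have := a4.symm; have := hxy.symm
    have := a6.symm; have := a7.symm; have := a8.symm; have := a9.symm; have := b1.symm
    have := b2.symm; have := b3.symm; have := b4.symm; have := b5.symm; have := b6.symm
    fin_cases i <;> fin_cases j <;>
      simp_all [switch_adj, _root_.c4TwoK1, graphOfEdges]

/-- Extension step, case of an induced `2K₂`, `v u` and `c d`. -/
theorem NoObs.step_2K2 {V : Type*} {K : SimpleGraph V} (h : NoObs K) {s : Set V} {x v u c d : V}
    (hs : AltFree K s) (hx : ∀ y, ¬ K.Adj x y)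
    (hc : c ∈ s) (hd : d ∈ s)
    (h1 : K.Adj v u) (h2 : K.Adj c d) (n1 : ¬ K.Adj v c) (n2 : ¬ K.Adj v d)
    (n3 : ¬ K.Adj u c) (n4 : ¬ K.Adj u d) : AltFree (_root_.switch K {v}) (insert v s) := by
  have sy : ∀ a b, K.Adj a b → K.Adj b a := fun a b h => h.symm
  have p4 := fun p q r t => h.no_p4 (p := p) (q := q) (r := r) (t := t) hx
  have bf := fun y p q c d => h.no_butterfly (y := y) (p := p) (q := q) (c := c) (d := d) hx
  have irr : ∀ a, ¬ K.Adj a a := fun a => K.loopless.irrefl a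
  -- a vertex attached to `v u` is not attached to `c d`
  have side : ∀ y, (K.Adj y v ∨ K.Adj y u) → ¬ K.Adj y c ∧ ¬ K.Adj y d := by
    intro y hy
    by_contra hcon
    by_cases e1 : K.Adj y v <;> by_cases e2 : K.Adj y u <;> by_cases e3 : K.Adj y c <;>
      by_cases e4 : K.Adj y d <;> grind
  have leaf : ∀ w ∈ s, K.Adj v w → ∀ y ∈ s, ¬ K.Adj w y := by
    intro w hw hvw y hy hwy
    have := side w (Or.inl hvw.symm)
    by_cases e3 : K.Adj y c
    · have := side y
      grind
    · by_cases e4 : K.Adj y d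
      · have := side y
        grind
      · exact hs w hw y hy c hc d hd hwy h2 (by rintro rfl; exact e4 h2)
          (by rintro rfl; exact this.1 h2.symm) e3 this.2
  clear p4 bf side n1 n2 n3 n4 h1 h2 hc hd
  intro a ha b hb c hc d hd e1 e2 e3 e4 e5 e6
  have hfin := hs a
  clear hs
  simp only [switch_adj, Set.mem_singleton_iff, Set.mem_insert_iff] at *
  by_cases a1 : a = v <;> by_cases b1 : b = v <;> by_cases c1 : c = v <;> by_cases d1 : d = v <;>
    simp only [a1, b1, c1, d1, false_or, true_or, iff_true, iff_false, true_iff, false_iff,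
      not_not, not_true_eq_false, not_false_eq_true, ne_eq, true_and, and_true] at * <;> grind

/-- Extension step, case of an induced `C₄`, `v c u d`. -/
theorem NoObs.step_C4 {V : Type*} {K : SimpleGraph V} (h : NoObs K) {s : Set V} {x v u c d : V}
    (hs : AltFree K s) (hx : ∀ y, ¬ K.Adj x y)
    (hc : c ∈ s) (hd : d ∈ s) (hvs : v ∉ s) (hxs : x ∈ s)
    (h1 : ¬ K.Adj v u) (hvu : v ≠ u) (h2 : ¬ K.Adj c d) (hcd : c ≠ d)
    (n1 : K.Adj v c) (n2 : K.Adj v d)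
    (n3 : K.Adj u c) (n4 : K.Adj u d) :
    AltFree (_root_.switch K {v, x}) (insert v s) := by
  have sy : ∀ a b, K.Adj a b → K.Adj b a := fun a b h => h.symm
  have p4 := fun p q r t => h.no_p4 (p := p) (q := q) (r := r) (t := t) hx
  have bf := fun y p q c d => h.no_c4 (y := y) (p := p) (q := q) (c := c) (d := d) hx
  have irr : ∀ a, ¬ K.Adj a a := fun a => K.loopless.irrefl a
  have side : ∀ y, y ≠ x → ((y ≠ v ∧ ¬ K.Adj y v) ∨ (y ≠ u ∧ ¬ K.Adj y u)) →
      (y ≠ c → K.Adj y c) ∧ (y ≠ d → K.Adj y d) := by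
    intro y hyx hy
    by_contra hcon
    by_cases e1 : K.Adj y v <;> by_cases e2 : K.Adj y u <;> by_cases e3 : K.Adj y c <;>
      by_cases e4 : K.Adj y d <;> grind
  have leaf : ∀ w ∈ s, w ≠ x → ¬ K.Adj v w → ∀ y ∈ s, y ≠ x → y ≠ w → K.Adj w y := by
    intro w hw hwx hvw y hy hyx hyw
    by_contra hwy
    have hsw := side w hwx (Or.inl ⟨by rintro rfl; exact hvs hw, fun h => hvw h.symm⟩)
    have hwc : K.Adj w c := hsw.1 (by rintro rfl; exact hvw n1)
    have hwd : K.Adj w d := hsw.2 (by rintro rfl; exact hvw n2)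
    have hyc : y ≠ c := by rintro rfl; exact hwy hwc
    have hyd : y ≠ d := by rintro rfl; exact hwy hwd
    have hyv : y ≠ v := by rintro rfl; exact hvs hy
    by_cases e0 : K.Adj y v
    · by_cases e3 : K.Adj y c
      · by_cases e4 : K.Adj y d
        · exact hs w hw c hc d hd y hy hwc e4.symm hcd hyw.symm h2 hwy
        · exact p4 y v d w e0 n2 hwd.symm e4 hvw (fun h => hwy h.symm) hyw
      · exact p4 y v c w e0 n1 hwc.symm e3 hvw (fun h => hwy h.symm) hyw
    · have hsy := side y hyx (Or.inl ⟨hyv, e0⟩)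
      exact hs w hw c hc d hd y hy hwc (hsy.2 hyd).symm hcd hyw.symm h2 hwy
  clear p4 bf side n1 n2 n3 n4 h1 h2 hc hd hcd hvu
  intro a ha b hb c hc d hd e1 e2 e3 e4 e5 e6
  have hfin := hs a
  clear hs
  simp only [switch_adj, Set.mem_singleton_iff, Set.mem_insert_iff] at *
  by_cases a1 : a = v <;> by_cases b1 : b = v <;> by_cases c1 : c = v <;> by_cases d1 : d = v <;>
    simp only [a1, b1, c1, d1, false_or, true_or, iff_true, iff_false, true_iff, false_iff,
      not_not, not_true_eq_false, not_false_eq_true, ne_eq, true_and, and_true] at * <;> grind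

theorem NoObs.step {V : Type*} [Fintype V] {G : SimpleGraph V} (h : NoObs G) {s : Set V} {v : V}
    (hvs : v ∉ s) (hne : s.Nonempty) {S : Set V} (hS : AltFree (_root_.switch G S) s) :
    ∃ S : Set V, AltFree (_root_.switch G S) (insert v s) := by
  obtain ⟨x, hxs, hx⟩ := hS.exists_vertex hne
  have hK := (h.switch S).switch {y | (_root_.switch G S).Adj x y}
  suffices hh : ∃ T, AltFree (_root_.switch (_root_.switch (_root_.switch G S)
      {y | (_root_.switch G S).Adj x y}) T) (insert v s) by
    obtain ⟨T, hT⟩ := hh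
    rw [switch_switch, switch_switch] at hT
    exact ⟨_, hT⟩
  generalize _root_.switch G S = K0 at *
  have hx0 : ∀ y, ¬ (_root_.switch K0 {y | K0.Adj x y}).Adj x y := by
    intro y
    rw [switch_adj]
    have := K0.loopless.irrefl x
    simp only [Set.mem_ofPred_eq]
    tauto
  have hs : AltFree (_root_.switch K0 {y | K0.Adj x y}) s := by
    intro a ha b hb c hc d hd e1 e2
    have ax : a ≠ x := by rintro rfl; exact hx0 _ e1
    have bx : b ≠ x := by rintro rfl; exact hx0 _ e1.symm
    have cx : c ≠ x := by rintro rfl; exact hx0 _ e2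
    have dx : d ≠ x := by rintro rfl; exact hx0 _ e2.symm
    have := hS a ha b hb c hc d hd
    simp only [switch_adj, Set.mem_ofPred_eq] at *
    rcases hx with hx | hx
    · have := hx a ha; have := hx b hb; have := hx c hc; have := hx d hd
      grind
    · have := hx a ha ax; have := hx b hb bx; have := hx c hc cx; have := hx d hd dx
      grind
  generalize _root_.switch K0 {y | K0.Adj x y} = K at *
  clear hS hx h
  by_contra hcon
  push Not at hcon
  have hv : ∀ u ∈ s, ∀ c ∈ s, ∀ d ∈ s, K.Adj v u → K.Adj c d → u ≠ c → v ≠ d →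
      ¬ K.Adj u c → ¬ K.Adj v d → False := by
    intro u hu c hc d hd h1 h2 h3 h4 h5 h6
    by_cases e1 : K.Adj v c <;> by_cases e2 : K.Adj u d
    · exact hcon _ (hK.step_C4 (u := d) (c := u) (d := c) hs hx0 hu hc hvs hxs h6 h4 h5 h3 h1 e1
        e2.symm h2.symm)
    · exact hK.no_p4 hx0 h1.symm e1 h2 h5 h6 e2 (by rintro rfl; exact h5 h2.symm)
    · exact hK.no_p4 hx0 h1 e2 h2.symm h6 h5 e1 (by rintro rfl; exact hvs hc)
    · exact hcon _ (hK.step_2K2 hs hx0 hc hd h1 h2 e1 h6 h5 e2)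
  apply hcon ∅
  have he : _root_.switch K ∅ = K := by
    ext a b
    rw [switch_adj]
    simp only [Set.mem_empty_iff_false, iff_true]
    exact ⟨fun h => h.2, fun h => ⟨h.ne, h⟩⟩
  rw [he]
  intro a ha b hb c hc d hd h1 h2 h3 h4 h5 h6
  have g : ∀ p q, ¬ K.Adj p q → ¬ K.Adj q p := fun p q h k => h k.symm
  have nab := h1.ne
  have ncd := h2.ne
  have nac : a ≠ c := by rintro rfl; exact h5 h1.symm
  have nbd : b ≠ d := by rintro rfl; exact h6 h1
  rw [Set.mem_insert_iff] at ha hb hc hd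
  by_cases hav : a = v
  · subst hav
    exact hv b (by grind) c (by grind) d (by grind) h1 h2 h3 h4 h5 h6
  by_cases hbv : b = v
  · subst hbv
    exact hv a (by grind) d (by grind) c (by grind) h1.symm h2.symm h4 h3 h6 h5
  by_cases hcv : c = v
  · subst hcv
    exact hv d (by grind) a (by grind) b (by grind) h2 h1 h4.symm h3.symm (g _ _ h6) (g _ _ h5)
  by_cases hdv : d = v
  · subst hdv
    exact hv c (by grind) b (by grind) a (by grind) h2.symm h1.symm h3.symm h4.symm
      (g _ _ h5) (g _ _ h6)
  exact hs a (by grind) b (by grind) c (by grind) d (by grind) h1 h2 h3 h4 h5 h6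

theorem NoObs.exists_switch {V : Type*} [Fintype V] {G : SimpleGraph V} (h : NoObs G) :
    ∃ S : Set V, IsThreshold (_root_.switch G S) := by
  classical
  have main : ∀ s : Finset V, ∃ S : Set V, AltFree (_root_.switch G S) s := by
    intro s
    induction s using Finset.induction_on with
    | empty => exact ⟨∅, fun a ha => by simp at ha⟩
    | insert v s hv ih =>
      obtain ⟨S, hS⟩ := ih
      rw [Finset.coe_insert]
      rcases (s : Set V).eq_empty_or_nonempty with he | hne
      · refine ⟨∅, ?_⟩
        rw [he]
        intro a ha b hb c hc d hd h1
        simp only [insert_empty_eq, Set.mem_singleton_iff] at ha hb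
        subst ha hb
        exact absurd h1 (SimpleGraph.irrefl _)
      · exact h.step (by simpa using hv) hne hS
  obtain ⟨S, hS⟩ := main Finset.univ
  rw [Finset.coe_univ] at hS
  exact ⟨S, hS.isThreshold⟩

/-- Boolean adjacency from an edge list. -/
def adjB {n : ℕ} (E : List (Fin n × Fin n)) (i j : Fin n) : Bool :=
  (E.contains (i, j) || E.contains (j, i))

/-- Boolean switched adjacency. -/
def swB {n : ℕ} (E : List (Fin n × Fin n)) (σ : Fin n → Bool) (i j : Fin n) : Bool :=
  (adjB E i j ^^ (σ i ^^ σ j))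

/-- Alternating quadruple test. -/
def altB {n : ℕ} (E : List (Fin n × Fin n)) (σ : Fin n → Bool) : Bool :=
  (List.finRange n).any fun a => (List.finRange n).any fun b =>
    (a != b && swB E σ a b) && (List.finRange n).any fun c => (b != c && !(swB E σ b c)) &&
    (List.finRange n).any fun d => (c != d && swB E σ c d) && (a != d && !(swB E σ a d))

theorem obstruction {V : Type*} {n : ℕ} {G : SimpleGraph V} {E : List (Fin n × Fin n)}
    (hE : ∀ σ, altB E σ = true) {S : Set V} (hS : IsThreshold (switch G S))
    {W : Set V} {T : Set W} (e : switch (G.induce W) T ≃g graphOfEdges n E) : False := by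
  classical
  set f : Fin n → W := fun i => e.symm i with hf
  have finj : Function.Injective f := e.symm.injective
  have hadj : ∀ i j, i ≠ j → ((switch (G.induce W) T).Adj (f i) (f j) ↔ adjB E i j = true) := by
    intro i j hij
    have h0 : (switch (G.induce W) T).Adj (f i) (f j) ↔ (graphOfEdges n E).Adj i j :=
      e.symm.map_adj_iff
    rw [h0]
    simp [graphOfEdges, adjB, hij]
  set σ : Fin n → Bool := fun i => decide (¬ ((f i : V) ∈ S ↔ f i ∈ T)) with hσ
  have key : ∀ i j, i ≠ j → ((switch G S).Adj (f i) (f j) ↔ swB E σ i j = true) := by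
    intro i j hij
    have h1 := hadj i j hij
    have hne : f i ≠ f j := fun h => hij (finj h)
    have hne' : (f i : V) ≠ f j := fun h => hne (Subtype.ext h)
    rw [switch_adj] at h1 ⊢
    simp only [SimpleGraph.comap_adj, Function.Embedding.subtype_apply] at h1
    unfold swB
    cases hb : adjB E i j <;> simp only [hb, hσ] at h1 ⊢ <;>
    by_cases a1 : (f i : V) ∈ S <;> by_cases a2 : (f j : V) ∈ S <;>
    by_cases a3 : f i ∈ T <;> by_cases a4 : f j ∈ T <;> simp_all
  have := hE σ
  simp only [altB, List.any_eq_true, List.mem_finRange, true_and, Bool.and_eq_true, bne_iff_ne,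
    Bool.not_eq_true'] at this
  obtain ⟨a, b, ⟨hab, h1⟩, c, ⟨hbc, h2⟩, d, ⟨hcd, h3⟩, had, h4⟩ := this
  refine hS.altFree Set.univ (f a) trivial (f b) trivial (f c) trivial (f d) trivial
    ((key _ _ hab).2 h1) ((key _ _ hcd).2 h3) ?_ ?_ ?_ ?_
  · exact fun h => hbc (finj (Subtype.ext h))
  · exact fun h => had (finj (Subtype.ext h))
  · rw [key _ _ hbc, h2]; simp
  · rw [key _ _ had, h4]; simp

theorem forall6 {P : (Fin 6 → Bool) → Prop}
    (h : ∀ a b c d e f : Bool, P ![a, b, c, d, e, f]) (σ : Fin 6 → Bool) : P σ := by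
  have := h (σ 0) (σ 1) (σ 2) (σ 3) (σ 4) (σ 5)
  convert this using 1
  ext i
  fin_cases i <;> rfl

theorem forall5 {P : (Fin 5 → Bool) → Prop}
    (h : ∀ a b c d e : Bool, P ![a, b, c, d, e]) (σ : Fin 5 → Bool) : P σ := by
  have := h (σ 0) (σ 1) (σ 2) (σ 3) (σ 4)
  convert this using 1
  ext i
  fin_cases i <;> rfl

theorem alt_threeK2 (σ) : altB (n := 6) [(0, 1), (2, 3), (4, 5)] σ = true := by
  revert σ
  exact forall6 (by decide +kernel)

theorem alt_cycle5 (σ) : altB (n := 5) [(0, 1), (1, 2), (2, 3), (3, 4), (4, 0)] σ = true := by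
  revert σ
  exact forall5 (by decide +kernel)

theorem alt_c4TwoK1 (σ) : altB (n := 6) [(0, 1), (1, 2), (2, 3), (3, 0)] σ = true := by
  revert σ
  exact forall6 (by decide +kernel)

/-- A finite simple graph `G` is switching equivalent to a threshold graph iff no induced
subgraph of `G` is switching equivalent to `3K₂`, to `C₅`, or to `C₄ + 2K₁`. -/
theorem switchingClass_threshold_iff {V : Type*} [Fintype V] (G : SimpleGraph V) :
    (∃ S : Set V, IsThreshold (switch G S)) ↔
      ¬ ∃ (W : Set V) (T : Set W),
        (Nonempty ((switch (G.induce W) T) ≃g threeK2) ∨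
         Nonempty ((switch (G.induce W) T) ≃g cycle5) ∨
         Nonempty ((switch (G.induce W) T) ≃g c4TwoK1)) := by
  constructor
  · rintro ⟨S, hS⟩ ⟨W, T, ⟨⟨e⟩⟩ | ⟨⟨e⟩⟩ | ⟨⟨e⟩⟩⟩
    · exact obstruction alt_threeK2 hS e
    · exact obstruction alt_cycle5 hS e
    · exact obstruction alt_c4TwoK1 hS e
  · intro h
    apply NoObs.exists_switch
    constructor
    · intro S f hf hh
      obtain ⟨W, T, e⟩ := exists_iso S f hf hh
      exact h ⟨W, T, Or.inl e⟩
    · intro S f hf hh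
      obtain ⟨W, T, e⟩ := exists_iso S f hf hh
      exact h ⟨W, T, Or.inr (Or.inl e)⟩
    · intro S f hf hh
      obtain ⟨W, T, e⟩ := exists_iso S f hf hh
      exact h ⟨W, T, Or.inr (Or.inr e)⟩
end
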